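/- Let μ ∈ ℂ with Re μ > −1, and let k, k' ∈ ℕ₀ with μ+k+1/2 ≠ 0 and μ+k'+1/2 ≠ 0. Then ∫_{−1}^{1} 𝖯_{k+μ}^{−μ}(x) 𝖯_{k'+μ}^{−μ}(x) dx = (k! / (Γ(2μ+k+1)(μ+k+1/2))) δ_{k,k'}, where δ_{k,k'} is the Kronecker delta. -/

import Mathlib

/-- Pochhammer symbol `(a)_k = a (a+1) ⋯ (a+k-1)` for complex `a`. -/
noncomputable def cpoch (a : ℂ) (k : ℕ) : ℂ := ∏ i ∈ Finset.range k, (a + i)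

/-- Gauss hypergeometric series `₂F₁(a, b; c; z)`. -/
noncomputable def hyp2F1 (a b c z : ℂ) : ℂ :=
  ∑' k : ℕ, cpoch a k * cpoch b k / (cpoch c k * (Nat.factorial k : ℂ)) * z ^ k

/-- Ferrers function of the first kind `𝖯_ν^{−μ}(x)`. -/
noncomputable def ferrersP (ν μ : ℂ) (x : ℝ) : ℂ :=
  (1 / Complex.Gamma (μ + 1)) * (((1 - x) / (1 + x) : ℝ) : ℂ) ^ (μ / 2) *
    hyp2F1 (-ν) (ν + 1) (μ + 1) (((1 - x) / 2 : ℝ) : ℂ)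

lemma cpoch_zero (a : ℂ) : cpoch a 0 = 1 := by simp [cpoch]

lemma cpoch_succ (a : ℂ) (n : ℕ) : cpoch a (n + 1) = cpoch a n * (a + n) :=
  Finset.prod_range_succ _ _

lemma cpoch_succ' (a : ℂ) (n : ℕ) : cpoch a (n + 1) = a * cpoch (a + 1) n := by
  simp only [cpoch, Finset.prod_range_succ', Nat.cast_add, Nat.cast_one, Nat.cast_zero, add_zero]
  rw [mul_comm]
  congr 1
  exact Finset.prod_congr rfl fun i _ => by ring

lemma cpoch_neg_nat_eq_zero {k n : ℕ} (h : k < n) : cpoch (-(k : ℂ)) n = 0 :=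
  Finset.prod_eq_zero (Finset.mem_range.mpr h) (by simp)

lemma cpoch_ne_zero {c : ℂ} (hc : ∀ n : ℕ, c + n ≠ 0) (n : ℕ) : cpoch c n ≠ 0 :=
  Finset.prod_ne_zero_iff.mpr fun i _ => hc i

/-- The coefficient of `z ^ n` in `₂F₁(a, b; c; z)`. -/
noncomputable def hypCoeff (a b c : ℂ) (n : ℕ) : ℂ :=
  cpoch a n * cpoch b n / (cpoch c n * (Nat.factorial n : ℂ))

lemma hypCoeff_zero (a b c : ℂ) : hypCoeff a b c 0 = 1 := by simp [hypCoeff, cpoch_zero]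

lemma hypCoeff_succ {a b c : ℂ} (hc : ∀ n : ℕ, c + n ≠ 0) (n : ℕ) :
    ((n : ℂ) + 1) * (c + n) * hypCoeff a b c (n + 1) = (a + n) * (b + n) * hypCoeff a b c n := by
  have h1 := cpoch_ne_zero hc n
  have h2 := hc n
  have h3 : (n : ℂ) + 1 ≠ 0 := Nat.cast_add_one_ne_zero n
  have h4 : (n.factorial : ℂ) ≠ 0 := Nat.cast_ne_zero.mpr n.factorial_ne_zero
  simp only [hypCoeff, cpoch_succ, Nat.factorial_succ, Nat.cast_mul, Nat.cast_add, Nat.cast_one]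
  field_simp

lemma eq_hypCoeff_of_recurrence {a b c : ℂ} (hc : ∀ n : ℕ, c + n ≠ 0) {f : ℕ → ℂ} (h0 : f 0 = 1)
    (h : ∀ n : ℕ, ((n : ℂ) + 1) * (c + n) * f (n + 1) = (a + n) * (b + n) * f n) (n : ℕ) :
    f n = hypCoeff a b c n := by
  induction n with
  | zero => rw [h0, hypCoeff_zero]
  | succ n ih =>
    have h3 : ((n : ℂ) + 1) * (c + n) ≠ 0 := mul_ne_zero (Nat.cast_add_one_ne_zero n) (hc n)
    exact mul_left_cancel₀ h3 (by rw [h n, hypCoeff_succ hc, ih])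

section PowerSeries

open PowerSeries

lemma coeff_hypergeometric_operator (a b c : ℂ) (f : ℂ⟦X⟧) (n : ℕ) :
    coeff n (X * (1 - X) * d⁄dX ℂ (d⁄dX ℂ f) + (C c - C (a + b + 1) * X) * d⁄dX ℂ f
      - C (a * b) * f) =
      ((n : ℂ) + 1) * (c + n) * coeff (n + 1) f - (a + n) * (b + n) * coeff n f := by
  have e : X * (1 - X) * d⁄dX ℂ (d⁄dX ℂ f) + (C c - C (a + b + 1) * X) * d⁄dX ℂ f
      - C (a * b) * f = X * d⁄dX ℂ (d⁄dX ℂ f) - X * (X * d⁄dX ℂ (d⁄dX ℂ f)) + C c * d⁄dX ℂ f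
      - C (a + b + 1) * (X * d⁄dX ℂ f) - C (a * b) * f := by ring
  have h : (a + n) * (b + n) = n * (n - 1) + (a + b + 1) * n + a * b := by ring
  rw [e, h]
  generalize a + b + 1 = d
  generalize a * b = e
  rcases n with _ | _ | n
  · simp only [map_sub, map_add, coeff_zero_X_mul, coeff_C_mul, coeff_derivative]
    push_cast
    ring
  · simp only [map_sub, map_add, coeff_succ_X_mul, coeff_zero_X_mul, coeff_C_mul, coeff_derivative]
    push_cast
    ring
  · simp only [map_sub, map_add, coeff_succ_X_mul, coeff_C_mul, coeff_derivative]
    push_cast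
    ring

lemma hypergeometric_ode {a b c : ℂ} (hc : ∀ n : ℕ, c + n ≠ 0) :
    X * (1 - X) * d⁄dX ℂ (d⁄dX ℂ (mk (hypCoeff a b c)))
      + (C c - C (a + b + 1) * X) * d⁄dX ℂ (mk (hypCoeff a b c))
      - C (a * b) * mk (hypCoeff a b c) = 0 := by
  ext n
  rw [coeff_hypergeometric_operator, coeff_mk, coeff_mk, hypCoeff_succ hc, sub_self, map_zero]

/-- **Euler's transformation**, for formal power series: `B` is the expansion of `(1 - z) ^ s`. -/
lemma euler_transformation_powerSeries {a b c : ℂ} (hc : ∀ n : ℕ, c + n ≠ 0) {B : ℂ⟦X⟧}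
    (hB0 : coeff 0 B = 1) (hB : (1 - X) * d⁄dX ℂ B = -(C (c - a - b) * B)) (n : ℕ) :
    coeff n (B * mk (hypCoeff (c - a) (c - b) c)) = hypCoeff a b c n := by
  refine eq_hypCoeff_of_recurrence (f := fun n => coeff n (B * mk (hypCoeff (c - a) (c - b) c))) hc
    (by simpa [hypCoeff_zero] using hB0) (fun n => ?_) n
  rw [← sub_eq_zero, ← coeff_hypergeometric_operator a b c]
  set p : ℂ⟦X⟧ := mk (hypCoeff (c - a) (c - b) c) with hp
  have hode := hypergeometric_ode (a := c - a) (b := c - b) hc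
  rw [← hp] at hode
  have hB' : (1 - X) * d⁄dX ℂ (d⁄dX ℂ B) = d⁄dX ℂ B - C (c - a - b) * d⁄dX ℂ B := by
    have := congrArg (d⁄dX ℂ) hB
    simp only [Derivation.leibniz, map_sub, map_neg, derivative_C, derivative_X, smul_eq_mul,
      derivative_one] at this
    simp only [map_sub]
    linear_combination this
  have hX : (1 - X : ℂ⟦X⟧) ≠ 0 := fun h => by
    simpa using congrArg (coeff 0) h
  suffices h : (1 - X) * (X * (1 - X) * d⁄dX ℂ (d⁄dX ℂ (B * p))
      + (C c - C (a + b + 1) * X) * d⁄dX ℂ (B * p) - C (a * b) * (B * p)) = 0 by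
    rw [(mul_eq_zero.mp h).resolve_left hX, map_zero]
  simp only [Derivation.leibniz, map_add, smul_eq_mul, map_sub, map_mul, map_one] at hode hB hB' ⊢
  linear_combination B * (1 - X) * hode
    + (2 * X * (1 - X) * d⁄dX ℂ p + X * (1 - (C c - C a - C b)) * p
      + (C c - (C a + C b + 1) * X) * p) * hB
    + X * (1 - X) * p * hB'

end PowerSeries

/-- The polynomial `₂F₁(-k, 2μ+k+1; μ+1; z)`, a multiple of the Jacobi polynomial `P_k^{(μ,μ)}`
in the variable `1 - 2z`. -/
noncomputable def ultrasphericalPoly (μ : ℂ) (k : ℕ) : Polynomial ℂ :=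
  ∑ j ∈ Finset.range (k + 1),
    Polynomial.monomial j (hypCoeff (-(k : ℂ)) (2 * μ + k + 1) (μ + 1) j)

lemma coeff_ultrasphericalPoly (μ : ℂ) (k n : ℕ) :
    (ultrasphericalPoly μ k).coeff n = hypCoeff (-(k : ℂ)) (2 * μ + k + 1) (μ + 1) n := by
  simp only [ultrasphericalPoly, Polynomial.finsetSum_coeff, Polynomial.coeff_monomial,
    Finset.sum_ite_eq', Finset.mem_range]
  split_ifs with h
  · rfl
  · rw [hypCoeff, cpoch_neg_nat_eq_zero (by omega), zero_mul, zero_div]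

lemma ultrasphericalPoly_zero (μ : ℂ) : ultrasphericalPoly μ 0 = 1 := by
  simp [ultrasphericalPoly, hypCoeff_zero]

lemma coe_ultrasphericalPoly (μ : ℂ) (k : ℕ) :
    (ultrasphericalPoly μ k : PowerSeries ℂ) =
      PowerSeries.mk (hypCoeff (-(k : ℂ)) (2 * μ + k + 1) (μ + 1)) := by
  ext n
  rw [Polynomial.coeff_coe, coeff_ultrasphericalPoly, PowerSeries.coeff_mk]

lemma add_one_add_natCast_ne_zero {μ : ℂ} (hμ : -1 < μ.re) (n : ℕ) : μ + 1 + n ≠ 0 := fun h => by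
  have h1 := congrArg Complex.re h
  simp only [Complex.add_re, Complex.one_re, Complex.natCast_re, Complex.zero_re] at h1
  have h2 : (0 : ℝ) ≤ n := n.cast_nonneg
  linarith

open Polynomial in
lemma ultrasphericalPoly_ode {μ : ℂ} (hμ : -1 < μ.re) (k : ℕ) :
    X * (1 - X) * derivative (derivative (ultrasphericalPoly μ k))
      + C (μ + 1) * (1 - 2 * X) * derivative (ultrasphericalPoly μ k)
      + C (k * (2 * μ + k + 1)) * ultrasphericalPoly μ k = 0 := by
  have h := hypergeometric_ode (a := -(k : ℂ)) (b := 2 * μ + k + 1)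
    (add_one_add_natCast_ne_zero hμ)
  rw [← coe_ultrasphericalPoly, PowerSeries.derivative_coe, PowerSeries.derivative_coe] at h
  apply Polynomial.coe_injective
  simp only [Polynomial.coe_add, Polynomial.coe_mul, Polynomial.coe_sub, Polynomial.coe_one,
    Polynomial.coe_X, Polynomial.coe_C, Polynomial.coe_zero, map_add, map_mul, map_neg,
    map_one] at h ⊢
  have h2 : ((2 : ℂ[X]) : PowerSeries ℂ) = 2 := by
    rw [show (2 : ℂ[X]) = 1 + 1 by norm_num, Polynomial.coe_add, Polynomial.coe_one]; norm_num
  have h2' : PowerSeries.C (2 : ℂ) = 2 := map_ofNat _ 2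
  rw [h2'] at h
  rw [h2, h2']
  linear_combination h

open Polynomial in
lemma derivative_ultrasphericalPoly_succ {μ : ℂ} (hμ : -1 < μ.re) (k : ℕ) :
    derivative (ultrasphericalPoly μ (k + 1)) =
      C (-((k : ℂ) + 1) * (2 * μ + k + 2) / (μ + 1)) * ultrasphericalPoly (μ + 1) k := by
  ext n
  have hc := add_one_add_natCast_ne_zero hμ
  have h0 : μ + 1 ≠ 0 := by simpa using hc 0
  have h1 : cpoch (μ + 1 + 1) n ≠ 0 := cpoch_ne_zero (fun m => by
    have := hc (m + 1)
    push_cast at this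
    rwa [add_assoc (μ + 1), add_comm (1 : ℂ)]) n
  have h3 : (n : ℂ) + 1 ≠ 0 := Nat.cast_add_one_ne_zero n
  have h4 : (n.factorial : ℂ) ≠ 0 := Nat.cast_ne_zero.mpr n.factorial_ne_zero
  rw [coeff_derivative, coeff_C_mul, coeff_ultrasphericalPoly, coeff_ultrasphericalPoly]
  simp only [hypCoeff, cpoch_succ', Nat.factorial_succ, Nat.cast_mul, Nat.cast_add, Nat.cast_one]
  rw [show -((k : ℂ) + 1) + 1 = -k by ring,
    show 2 * μ + (k + 1) + 1 + 1 = 2 * (μ + 1) + k + 1 by ring]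
  field_simp
  ring

section Binomial

lemma neg_one_pow_mul_choose_succ (μ : ℂ) (n : ℕ) :
    (-1) ^ (n + 1) * Ring.choose μ (n + 1) * ((n : ℂ) + 1) =
      (n - μ) * ((-1) ^ n * Ring.choose μ n) := by
  have h := Ring.choose_smul_choose μ (Nat.le_succ n)
  simp only [Nat.succ_eq_add_one, Nat.choose_succ_self_right, Nat.add_sub_cancel_left,
    Ring.choose_one_right, nsmul_eq_mul, Nat.cast_add, Nat.cast_one] at h
  rw [pow_succ]
  linear_combination -(-1 : ℂ) ^ n * h

lemma hasSum_one_sub_cpow (μ : ℂ) {z : ℂ} (hz : ‖z‖ < 1) :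
    HasSum (fun n : ℕ => (-1) ^ n * Ring.choose μ n * z ^ n) ((1 - z) ^ μ) := by
  have h := (Complex.one_add_cpow_hasFPowerSeriesOnBall_zero (a := μ)).hasSum (y := -z)
    (by rw [Metric.mem_eball, edist_zero_right, enorm_neg, ← ofReal_norm]
        exact ENNReal.ofReal_lt_one.mpr hz)
  rw [zero_add, ← sub_eq_add_neg] at h
  refine h.congr_fun fun n => ?_
  rw [binomialSeries_apply, List.ofFn_const, List.prod_replicate, neg_pow, smul_eq_mul]
  ring

lemma summable_norm_one_sub_cpow (μ : ℂ) {z : ℂ} (hz : ‖z‖ < 1) :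
    Summable fun n : ℕ => ‖(-1) ^ n * Ring.choose μ n * z ^ n‖ :=
  (hasSum_one_sub_cpow μ hz).summable.norm

open PowerSeries in
lemma one_sub_X_mul_derivative_binomial (μ : ℂ) :
    (1 - X) * d⁄dX ℂ (mk fun n : ℕ => (-1) ^ n * Ring.choose μ n) =
      -(C μ * mk fun n : ℕ => (-1) ^ n * Ring.choose μ n) := by
  ext n
  rw [sub_mul, one_mul, map_sub, coeff_derivative, coeff_mk, neg_one_pow_mul_choose_succ]
  rcases n with _ | n
  · simp
  · rw [coeff_succ_X_mul, coeff_derivative, map_neg, coeff_C_mul, coeff_mk]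
    push_cast
    ring

lemma hyp2F1_eq_cpow_mul_ultrasphericalPoly {μ : ℂ} (hμ : -1 < μ.re) (k : ℕ) {z : ℂ}
    (hz : ‖z‖ < 1) :
    hyp2F1 (-(k + μ)) (k + μ + 1) (μ + 1) z = (1 - z) ^ μ * (ultrasphericalPoly μ k).eval z := by
  have hp : HasSum (fun n => (ultrasphericalPoly μ k).coeff n * z ^ n)
      ((ultrasphericalPoly μ k).eval z) := by
    rw [Polynomial.eval_eq_sum_range]
    exact hasSum_sum_of_ne_finset_zero fun n hn => by
      rw [Polynomial.coeff_eq_zero_of_natDegree_lt (by simpa using hn), zero_mul]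
  rw [← (hasSum_one_sub_cpow μ hz).tsum_eq, ← hp.tsum_eq,
    tsum_mul_tsum_eq_tsum_sum_antidiagonal_of_summable_norm (summable_norm_one_sub_cpow μ hz)
      hp.summable.norm]
  refine tsum_congr fun n => ?_
  have h := euler_transformation_powerSeries (a := -(k + μ)) (b := k + μ + 1)
    (add_one_add_natCast_ne_zero hμ)
    (B := PowerSeries.mk fun n : ℕ => (-1) ^ n * Ring.choose μ n) (by simp)
    (by rw [show μ + 1 - -(k + μ) - (k + μ + 1) = μ by ring]
        exact one_sub_X_mul_derivative_binomial μ) n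
  rw [← hypCoeff, ← h, show μ + 1 - (k + μ + 1) = -(k : ℂ) by ring,
    show μ + 1 - -(k + μ) = 2 * μ + k + 1 by ring, PowerSeries.coeff_mul, Finset.sum_mul]
  refine Finset.sum_congr rfl fun ij hij => ?_
  rw [PowerSeries.coeff_mk, PowerSeries.coeff_mk, coeff_ultrasphericalPoly,
    ← Finset.HasAntidiagonal.mem_antidiagonal.mp hij, pow_add]
  simp only [hypCoeff]
  ring

end Binomial

section Integral

open Polynomial MeasureTheory

/-- The functional `p ↦ ∫₀¹ z^μ (1 - z)^μ p(z) dz` on polynomials. -/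
noncomputable def ultrasphericalIntegral (μ : ℂ) (p : ℂ[X]) : ℂ :=
  ∫ x in (0 : ℝ)..1, (x : ℂ) ^ μ * (1 - (x : ℂ)) ^ μ * p.eval (x : ℂ)

lemma intervalIntegrable_weight_mul {μ : ℂ} (hμ : -1 < μ.re) (p : ℂ[X]) :
    IntervalIntegrable (fun x : ℝ => (x : ℂ) ^ μ * (1 - (x : ℂ)) ^ μ * p.eval (x : ℂ))
      volume 0 1 := by
  have h : 0 < (μ + 1).re := by simpa using by linarith
  have hw := Complex.betaIntegral_convergent h h
  rw [add_sub_cancel_right] at hw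
  exact hw.mul_continuousOn (p.continuous.comp Complex.continuous_ofReal).continuousOn

lemma ultrasphericalIntegral_add {μ : ℂ} (hμ : -1 < μ.re) (p q : ℂ[X]) :
    ultrasphericalIntegral μ (p + q) = ultrasphericalIntegral μ p + ultrasphericalIntegral μ q := by
  rw [ultrasphericalIntegral, ultrasphericalIntegral, ultrasphericalIntegral,
    ← intervalIntegral.integral_add (intervalIntegrable_weight_mul hμ p)
      (intervalIntegrable_weight_mul hμ q)]
  simp only [eval_add, mul_add]

lemma ultrasphericalIntegral_C_mul (μ c : ℂ) (p : ℂ[X]) :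
    ultrasphericalIntegral μ (C c * p) = c * ultrasphericalIntegral μ p := by
  rw [ultrasphericalIntegral, ultrasphericalIntegral, ← intervalIntegral.integral_const_mul]
  simp only [eval_mul, eval_C, mul_left_comm]

lemma cpow_add_one_of_pos {x : ℝ} (hx : 0 < x) (μ : ℂ) : (x : ℂ) ^ (μ + 1) = x ^ μ * x := by
  rw [Complex.cpow_add _ _ (by exact_mod_cast hx.ne'), Complex.cpow_one]

lemma ultrasphericalIntegral_add_one (μ : ℂ) (p : ℂ[X]) :
    ultrasphericalIntegral (μ + 1) p = ultrasphericalIntegral μ (X * (1 - X) * p) := by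
  refine intervalIntegral.integral_congr_Ioo_of_le zero_le_one fun x hx => ?_
  have h1 : (0 : ℝ) < 1 - x := by linarith [hx.2]
  have h2 := cpow_add_one_of_pos h1 μ
  push_cast at h2
  simp only [cpow_add_one_of_pos hx.1, h2, eval_mul, eval_X, eval_sub, eval_one]
  ring

lemma ultrasphericalIntegral_derivative {μ : ℂ} (hμ : -1 < μ.re) (r : ℂ[X]) :
    ultrasphericalIntegral μ
      (X * (1 - X) * derivative r + C (μ + 1) * (1 - 2 * X) * r) = 0 := by
  have h : 0 < (μ + 1).re := by simpa using by linarith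
  have h0 : μ + 1 ≠ 0 := fun h' => by simp [h'] at h
  have hcont : Continuous fun x : ℝ =>
      (x : ℂ) ^ (μ + 1) * (1 - (x : ℂ)) ^ (μ + 1) * r.eval (x : ℂ) := by
    have h1 := Complex.continuous_ofReal_cpow_const h
    have h2 := h1.comp (show Continuous fun x : ℝ => 1 - x by fun_prop)
    simp only [Function.comp_def, Complex.ofReal_sub, Complex.ofReal_one] at h2
    exact (h1.mul h2).mul (r.continuous.comp Complex.continuous_ofReal)
  have key := intervalIntegral.integral_eq_sub_of_hasDerivAt_of_le zero_le_one hcont.continuousOn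
    (fun x hx => ?_) (intervalIntegrable_weight_mul hμ
      (X * (1 - X) * derivative r + C (μ + 1) * (1 - 2 * X) * r))
  · rw [ultrasphericalIntegral, key]
    simp [Complex.zero_cpow h0]
  · have h1 : (0 : ℝ) < 1 - x := by linarith [hx.2]
    have h2 := cpow_add_one_of_pos h1 μ
    push_cast at h2
    have d1 := (hasDerivAt_id (x : ℂ)).cpow_const (c := μ + 1)
      (Complex.ofReal_mem_slitPlane.mpr hx.1)
    have d2 := ((hasDerivAt_id (x : ℂ)).const_sub 1).cpow_const (c := μ + 1)
      (by simpa using Complex.ofReal_mem_slitPlane.mpr h1)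
    have d := ((d1.mul d2).mul (r.hasDerivAt (x : ℂ))).comp_ofReal
    refine d.congr_deriv ?_
    simp only [id_eq, add_sub_cancel_right, h2, cpow_add_one_of_pos hx.1, Pi.mul_apply, eval_add,
      eval_mul, eval_sub, eval_one, eval_X, eval_C, eval_ofNat]
    ring

lemma ultrasphericalIntegral_mul_eq {μ : ℂ} (hμ : -1 < μ.re) (k : ℕ) (q : ℂ[X]) :
    k * (2 * μ + k + 1) * ultrasphericalIntegral μ (ultrasphericalPoly μ k * q) =
      ultrasphericalIntegral (μ + 1) (derivative (ultrasphericalPoly μ k) * derivative q) := by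
  have h := ultrasphericalIntegral_derivative hμ (derivative (ultrasphericalPoly μ k) * q)
  have e : X * (1 - X) * derivative (derivative (ultrasphericalPoly μ k) * q)
      + C (μ + 1) * (1 - 2 * X) * (derivative (ultrasphericalPoly μ k) * q) =
      X * (1 - X) * (derivative (ultrasphericalPoly μ k) * derivative q)
      + C (-(k * (2 * μ + k + 1))) * (ultrasphericalPoly μ k * q) := by
    rw [derivative_mul, C_neg]
    linear_combination q * ultrasphericalPoly_ode hμ k
  rw [e, ultrasphericalIntegral_add hμ, ultrasphericalIntegral_C_mul,
    ← ultrasphericalIntegral_add_one] at h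
  linear_combination -h

lemma two_mul_add_natCast_add_two_ne_zero {μ : ℂ} (hμ : -1 < μ.re) (k : ℕ) :
    2 * μ + k + 2 ≠ 0 := fun h => by
  have h1 := congrArg Complex.re h
  simp at h1
  have h2 : (0 : ℝ) ≤ k := k.cast_nonneg
  linarith

lemma ultrasphericalIntegral_succ_zero {μ : ℂ} (hμ : -1 < μ.re) (k : ℕ) :
    ultrasphericalIntegral μ (ultrasphericalPoly μ (k + 1) * ultrasphericalPoly μ 0) = 0 := by
  have h := ultrasphericalIntegral_mul_eq hμ (k + 1) (ultrasphericalPoly μ 0)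
  rw [ultrasphericalPoly_zero μ, derivative_one, mul_zero] at h
  have h0 : ultrasphericalIntegral (μ + 1) 0 = 0 := by simp [ultrasphericalIntegral]
  have h1 : ((k + 1 : ℕ) : ℂ) ≠ 0 := Nat.cast_ne_zero.mpr k.succ_ne_zero
  have h2 : 2 * μ + (k + 1 : ℕ) + 1 ≠ 0 := by
    have := two_mul_add_natCast_add_two_ne_zero hμ k
    push_cast
    rwa [add_assoc, add_assoc, one_add_one_eq_two, ← add_assoc]
  rw [h0] at h
  rw [ultrasphericalPoly_zero]
  exact (mul_eq_zero.mp h).resolve_left (mul_ne_zero h1 h2)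

lemma ultrasphericalIntegral_succ_succ {μ : ℂ} (hμ : -1 < μ.re) (k k' : ℕ) :
    (μ + 1) ^ 2 *
        ultrasphericalIntegral μ (ultrasphericalPoly μ (k + 1) * ultrasphericalPoly μ (k' + 1)) =
      ((k' : ℂ) + 1) * (2 * μ + k' + 2) *
        ultrasphericalIntegral (μ + 1)
          (ultrasphericalPoly (μ + 1) k * ultrasphericalPoly (μ + 1) k') := by
  have h := ultrasphericalIntegral_mul_eq hμ (k + 1) (ultrasphericalPoly μ (k' + 1))
  have h0 : μ + 1 ≠ 0 := by simpa using add_one_add_natCast_ne_zero hμ 0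
  have h1 : (k : ℂ) + 1 ≠ 0 := Nat.cast_add_one_ne_zero k
  have h2 := two_mul_add_natCast_add_two_ne_zero hμ k
  rw [derivative_ultrasphericalPoly_succ hμ, derivative_ultrasphericalPoly_succ hμ,
    mul_mul_mul_comm, ← C_mul, ultrasphericalIntegral_C_mul] at h
  push_cast at h
  refine mul_left_cancel₀ (mul_ne_zero h1 h2) ?_
  field_simp at h
  linear_combination ((k : ℂ) + 1) * h

lemma ultrasphericalIntegral_one {μ : ℂ} (hμ : -1 < μ.re) (hμ' : 2 * μ + 1 ≠ 0) :
    ultrasphericalIntegral μ 1 =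
      Complex.Gamma (μ + 1) ^ 2 / (Complex.Gamma (2 * μ + 1) * (2 * μ + 1)) := by
  have h : 0 < (μ + 1).re := by simpa using by linarith
  have hG : Complex.Gamma (2 * μ + 1 + 1) ≠ 0 :=
    Complex.Gamma_ne_zero_of_re_pos (by simp; linarith)
  have hb := Complex.Gamma_mul_Gamma_eq_betaIntegral h h
  rw [Complex.betaIntegral, add_sub_cancel_right,
    show μ + 1 + (μ + 1) = 2 * μ + 1 + 1 by ring] at hb
  simp only [ultrasphericalIntegral, eval_one, mul_one]
  rw [mul_comm _ (2 * μ + 1), ← Complex.Gamma_add_one _ hμ', pow_two, hb,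
    mul_div_cancel_left₀ _ hG]

lemma ultrasphericalIntegral_mul {μ : ℂ} (hμ : -1 < μ.re) (k k' : ℕ)
    (hk : 2 * μ + 2 * k + 1 ≠ 0) :
    ultrasphericalIntegral μ (ultrasphericalPoly μ k * ultrasphericalPoly μ k') =
      if k = k' then
        Complex.Gamma (μ + 1) ^ 2 * (k.factorial : ℂ) /
          (Complex.Gamma (2 * μ + k + 1) * (2 * μ + 2 * k + 1))
      else 0 := by
  induction k generalizing μ k' with
  | zero =>
    rcases k' with _ | k'
    · have := ultrasphericalIntegral_one hμ (by simpa using hk)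
      simpa [ultrasphericalPoly_zero] using this
    · rw [mul_comm, ultrasphericalIntegral_succ_zero hμ, if_neg (Nat.succ_ne_zero k').symm]
  | succ k ih =>
    rcases k' with _ | k'
    · rw [ultrasphericalIntegral_succ_zero hμ, if_neg (Nat.succ_ne_zero k)]
    · have h0 : μ + 1 ≠ 0 := by simpa using add_one_add_natCast_ne_zero hμ 0
      have h2 := two_mul_add_natCast_add_two_ne_zero hμ k'
      push_cast at hk
      have hs := ultrasphericalIntegral_succ_succ hμ k k'
      rw [ih (by simp; linarith) k' (by convert hk using 1; ring)] at hs
      refine mul_left_cancel₀ (pow_ne_zero 2 h0) (hs.trans ?_)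
      by_cases hkk : k = k'
      · subst hkk
        have hG : Complex.Gamma (2 * μ + k + 2) ≠ 0 :=
          Complex.Gamma_ne_zero_of_re_pos (by
            have h2 : (0 : ℝ) ≤ k := k.cast_nonneg
            simp; linarith)
        have hk2 : 2 * μ + 2 * k + 3 ≠ 0 := by convert hk using 1; ring
        rw [if_pos rfl, if_pos rfl, Complex.Gamma_add_one _ h0, Nat.factorial_succ]
        push_cast
        rw [show 2 * (μ + 1) + k + 1 = 2 * μ + k + 2 + 1 by ring,
          Complex.Gamma_add_one _ h2,
          show 2 * (μ + 1) + 2 * k + 1 = 2 * μ + 2 * k + 3 by ring,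
          show 2 * μ + 2 * ((k : ℂ) + 1) + 1 = 2 * μ + 2 * k + 3 by ring,
          show 2 * μ + ((k : ℂ) + 1) + 1 = 2 * μ + k + 2 by ring]
        field_simp
      · rw [if_neg hkk, if_neg (by simpa using hkk), mul_zero, mul_zero]

lemma ferrersP_mul_ferrersP {μ : ℂ} (hμ : -1 < μ.re) (k k' : ℕ) {x : ℝ} (hx0 : 0 < x)
    (hx1 : x < 1) :
    ferrersP (k + μ) μ (1 - 2 * x) * ferrersP (k' + μ) μ (1 - 2 * x) =
      (Complex.Gamma (μ + 1) ^ 2)⁻¹ * ((x : ℂ) ^ μ * (1 - (x : ℂ)) ^ μ *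
        (ultrasphericalPoly μ k * ultrasphericalPoly μ k').eval (x : ℂ)) := by
  have h1 : 0 < 1 - x := sub_pos.mpr hx1
  have hn : ‖(x : ℂ)‖ < 1 := by rwa [Complex.norm_of_nonneg hx0.le]
  have e1 : (1 - (1 - 2 * x)) / (1 + (1 - 2 * x)) = x / (1 - x) := by
    rw [show 1 + (1 - 2 * x) = 2 * (1 - x) by ring, sub_sub_cancel, mul_div_mul_left _ _ two_ne_zero]
  have e2 : (1 - (1 - 2 * x)) / 2 = x := by ring
  have h3 : (1 - x : ℂ) ^ μ ≠ 0 := by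
    rw [Complex.cpow_ne_zero_iff]
    exact Or.inl (by exact_mod_cast h1.ne')
  have h4 : ((x / (1 - x) : ℝ) : ℂ) ^ (μ / 2) * ((x / (1 - x) : ℝ) : ℂ) ^ (μ / 2) =
      (x : ℂ) ^ μ / (1 - x : ℂ) ^ μ := by
    rw [← Complex.cpow_add _ _ (by exact_mod_cast (div_pos hx0 h1).ne'), add_halves,
      Complex.ofReal_div, Complex.div_cpow_ofReal_nonneg hx0.le h1.le, Complex.ofReal_sub,
      Complex.ofReal_one]
  rw [ferrersP, ferrersP, e1, e2, hyp2F1_eq_cpow_mul_ultrasphericalPoly hμ k hn,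
    hyp2F1_eq_cpow_mul_ultrasphericalPoly hμ k' hn, eval_mul]
  rw [eq_div_iff h3] at h4
  linear_combination (Complex.Gamma (μ + 1) ^ 2)⁻¹ * (1 - x : ℂ) ^ μ *
    (ultrasphericalPoly μ k).eval (x : ℂ) * (ultrasphericalPoly μ k').eval (x : ℂ) * h4

end Integral

theorem ferrersP_orthogonality (μ : ℂ) (hμ : -1 < μ.re) (k k' : ℕ)
    (hk : μ + k + 1 / 2 ≠ 0) (hk' : μ + k' + 1 / 2 ≠ 0) :
    ∫ x in (-1 : ℝ)..1, ferrersP ((k : ℂ) + μ) μ x * ferrersP ((k' : ℂ) + μ) μ x =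
      if k = k' then
        (Nat.factorial k : ℂ) / (Complex.Gamma (2 * μ + k + 1) * (μ + k + 1 / 2))
      else 0 := by
  have hsub := intervalIntegral.integral_comp_sub_mul (a := 0) (b := 1)
    (fun x : ℝ => ferrersP (k + μ) μ x * ferrersP (k' + μ) μ x) (two_ne_zero (α := ℝ)) 1
  norm_num only at hsub
  have hint : ∫ x in (0 : ℝ)..1, ferrersP (k + μ) μ (1 - 2 * x) * ferrersP (k' + μ) μ (1 - 2 * x) =
      (Complex.Gamma (μ + 1) ^ 2)⁻¹ *
        ultrasphericalIntegral μ (ultrasphericalPoly μ k * ultrasphericalPoly μ k') := by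
    rw [ultrasphericalIntegral, ← intervalIntegral.integral_const_mul]
    exact intervalIntegral.integral_congr_Ioo_of_le zero_le_one
      fun x hx => ferrersP_mul_ferrersP hμ k k' hx.1 hx.2
  have e : 2 * μ + 2 * k + 1 = 2 * (μ + k + 1 / 2) := by ring
  have hG : Complex.Gamma (μ + 1) ≠ 0 :=
    Complex.Gamma_ne_zero_of_re_pos (by simpa using by linarith)
  rw [hint, ultrasphericalIntegral_mul hμ k k' (by rw [e]; exact mul_ne_zero two_ne_zero hk),
    e, Complex.real_smul] at hsub
  push_cast at hsub
  have h2 := congrArg (2 * ·) hsub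
  rw [← mul_assoc 2 (1 / 2 : ℂ), mul_one_div_cancel two_ne_zero, one_mul] at h2
  rw [← h2]
  split_ifs
  · rw [mul_left_comm _ 2, mul_div_assoc, inv_mul_cancel_left₀ (pow_ne_zero 2 hG), mul_div_assoc',
      mul_div_mul_left _ _ two_ne_zero]
  · simp
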